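/- arXiv:1506.06961 — 2 statements merged into one kernel-verified Lean document; each statement's English description precedes it below -/
import Mathlib

section
/- For all natural numbers a, b, c, n with a ≤ b ≤ c ≤ n, the Sprague–Grundy value satisfies G(a, b, c) = G(n−c, n−b, n−a) (every position has the same Grundy value as its complement with respect to any level n ≥ c). -/
namespace SharingNim

/-- The moves of three-pile Sharing Nim: take `k ≥ 1` tokens from one pile and add them to
another pile, provided the receiving pile has at most as many tokens as the source pile
after the move (i.e. `2 * k` is at most the difference of the two piles). -/
def moves : ℕ × ℕ × ℕ → Finset (ℕ × ℕ × ℕ)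
  | (a, b, c) =>
    ((Finset.Icc 1 ((b - a) / 2)).image fun k => (a + k, b - k, c)) ∪
    ((Finset.Icc 1 ((a - b) / 2)).image fun k => (a - k, b + k, c)) ∪
    ((Finset.Icc 1 ((c - a) / 2)).image fun k => (a + k, b, c - k)) ∪
    ((Finset.Icc 1 ((a - c) / 2)).image fun k => (a - k, b, c + k)) ∪
    ((Finset.Icc 1 ((c - b) / 2)).image fun k => (a, b + k, c - k)) ∪
    ((Finset.Icc 1 ((b - c) / 2)).image fun k => (a, b - k, c + k))

/-- The sum of squares of the pile sizes, a measure that strictly decreases along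
every move. -/
def measure3 (p : ℕ × ℕ × ℕ) : ℕ := p.1 ^ 2 + p.2.1 ^ 2 + p.2.2 ^ 2

theorem sq_move_lt {x y k : ℕ} (hk : 1 ≤ k) (h : k ≤ (y - x) / 2) :
    (x + k) ^ 2 + (y - k) ^ 2 < x ^ 2 + y ^ 2 := by
  have h1 : x + 2 * k ≤ y := by omega
  have h2 : k ≤ y := by omega
  zify [h2]
  nlinarith

theorem measure3_lt_of_mem_moves {q p : ℕ × ℕ × ℕ} (h : q ∈ moves p) :
    measure3 q < measure3 p := by
  obtain ⟨a, b, c⟩ := p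
  simp only [moves, Finset.mem_union, Finset.mem_image, Finset.mem_Icc] at h
  rcases h with ((((⟨k, ⟨hk1, hk2⟩, rfl⟩ | ⟨k, ⟨hk1, hk2⟩, rfl⟩) | ⟨k, ⟨hk1, hk2⟩, rfl⟩) |
      ⟨k, ⟨hk1, hk2⟩, rfl⟩) | ⟨k, ⟨hk1, hk2⟩, rfl⟩) | ⟨k, ⟨hk1, hk2⟩, rfl⟩ <;>
    simp only [measure3] <;>
    [linarith [sq_move_lt (x := a) (y := b) hk1 hk2];
     linarith [sq_move_lt (x := b) (y := a) hk1 hk2];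
     linarith [sq_move_lt (x := a) (y := c) hk1 hk2];
     linarith [sq_move_lt (x := c) (y := a) hk1 hk2];
     linarith [sq_move_lt (x := b) (y := c) hk1 hk2];
     linarith [sq_move_lt (x := c) (y := b) hk1 hk2]]

/-- The minimum excludant of a finite set of naturals. -/
noncomputable def mex (s : Finset ℕ) : ℕ := sInf {n : ℕ | n ∉ s}

/-- The Sprague–Grundy value of a position of three-pile Sharing Nim: the minimum
excludant of the Sprague–Grundy values of the positions reachable in one move. -/
noncomputable def G (p : ℕ × ℕ × ℕ) : ℕ :=
  mex ((moves p).attach.image fun q => G q.1)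
termination_by measure3 p
decreasing_by exact measure3_lt_of_mem_moves q.2

/-- Complement of a position with respect to level `n`. -/
def comp (n : ℕ) (p : ℕ × ℕ × ℕ) : ℕ × ℕ × ℕ := (n - p.2.2, n - p.2.1, n - p.1)

/-- All piles are at most `n`. -/
def Bdd (n : ℕ) (p : ℕ × ℕ × ℕ) : Prop := p.1 ≤ n ∧ p.2.1 ≤ n ∧ p.2.2 ≤ n

theorem comp_comp {n : ℕ} {p : ℕ × ℕ × ℕ} (h : Bdd n p) : comp n (comp n p) = p := by
  obtain ⟨a, b, c⟩ := p
  obtain ⟨h1, h2, h3⟩ := h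
  simp only [comp, Prod.mk.injEq] at *
  omega

theorem bdd_comp (n : ℕ) (p : ℕ × ℕ × ℕ) : Bdd n (comp n p) := by
  simp [Bdd, comp]

theorem comp_move {n : ℕ} {p q : ℕ × ℕ × ℕ} (hp : Bdd n p) (h : q ∈ moves p) :
    Bdd n q ∧ comp n q ∈ moves (comp n p) := by
  obtain ⟨a, b, c⟩ := p
  obtain ⟨h1, h2, h3⟩ := hp
  simp only [moves, comp, Finset.mem_union, Finset.mem_image, Finset.mem_Icc] at *
  rcases h with ((((⟨k, hk, rfl⟩ | ⟨k, hk, rfl⟩) | ⟨k, hk, rfl⟩) |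
      ⟨k, hk, rfl⟩) | ⟨k, hk, rfl⟩) | ⟨k, hk, rfl⟩ <;>
    refine ⟨⟨by dsimp only; omega, by dsimp only; omega, by dsimp only; omega⟩, ?_⟩
  · exact Or.inl (Or.inr ⟨k, by omega, by ext <;> dsimp only <;> omega⟩)
  · exact Or.inr ⟨k, by omega, by ext <;> dsimp only <;> omega⟩
  · exact Or.inl (Or.inl (Or.inl (Or.inr ⟨k, by omega, by ext <;> dsimp only <;> omega⟩)))
  · exact Or.inl (Or.inl (Or.inr ⟨k, by omega, by ext <;> dsimp only <;> omega⟩))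
  · exact Or.inl (Or.inl (Or.inl (Or.inl (Or.inl ⟨k, by omega, by ext <;> dsimp only <;> omega⟩))))
  · exact Or.inl (Or.inl (Or.inl (Or.inl (Or.inr ⟨k, by omega, by ext <;> dsimp only <;> omega⟩))))

theorem G_comp (n m : ℕ) : ∀ p, measure3 p < m → Bdd n p → G p = G (comp n p) := by
  induction m with
  | zero => intro p h; omega
  | succ m ih =>
    intro p hm hp
    rw [G, G]
    congr 1
    ext x
    simp only [Finset.mem_image, Finset.mem_attach, true_and, Subtype.exists, exists_prop]
    constructor
    · rintro ⟨q, hq, rfl⟩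
      have := measure3_lt_of_mem_moves hq
      obtain ⟨hb, hc⟩ := comp_move hp hq
      exact ⟨_, hc, (ih q (by omega) hb).symm⟩
    · rintro ⟨r, hr, rfl⟩
      obtain ⟨hb, hc⟩ := comp_move (bdd_comp n p) hr
      rw [comp_comp hp] at hc
      have := measure3_lt_of_mem_moves hc
      refine ⟨_, hc, ?_⟩
      rw [ih _ (by omega) (bdd_comp n r), comp_comp hb]

/-- For all naturals `a ≤ b ≤ c ≤ n`, a position has the same Grundy value
as its complement with respect to level `n`. -/
theorem grundy_complement (a b c n : ℕ) (hab : a ≤ b) (hbc : b ≤ c) (hcn : c ≤ n) :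
    G (a, b, c) = G (n - c, n - b, n - a) :=
  G_comp n _ (a, b, c) (Nat.lt_succ_self _)
    ⟨by dsimp only; omega, by dsimp only; omega, hcn⟩

end SharingNim
end

section
/- For all natural numbers a, b with 0 < a < b, the Sprague–Grundy value G(0, a, b) is nonzero; that is, every P-position of the form (0,a,b) with a ≤ b has a = 0 or a = b. -/
namespace SharingNim

/-- `n = 0` or the 2-adic valuation of `n` is even. -/
def EV (n : ℕ) : Prop := n = 0 ∨ Even (padicValNat 2 n)

theorem EV_odd {n : ℕ} (h : n % 2 = 1) : EV n := by
  right
  rw [padicValNat.eq_zero_of_not_dvd (by omega)]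
  exact Even.zero

theorem EV_double {n : ℕ} (h : 0 < n) : EV (2 * n) ↔ ¬ EV n := by
  have : Fact (Nat.Prime 2) := ⟨Nat.prime_two⟩
  have h1 : padicValNat 2 (2 * n) = 1 + padicValNat 2 n := by
    rw [padicValNat.mul (by omega) (by omega), padicValNat.self (by omega)]
  unfold EV
  rw [h1, Nat.even_add]
  have h2 : ¬ Even 1 := by decide
  have h3 : n ≠ 0 := by omega
  simp [h3, h2]

/-- Distance of naturals. -/
def ds (x y : ℕ) : ℕ := (x - y) + (y - x)

/-- The P-positions: two equal piles, difference to the third satisfies `EV`. -/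
def Pos (p : ℕ × ℕ × ℕ) : Prop :=
  (p.1 = p.2.1 ∧ EV (ds p.1 p.2.2)) ∨ (p.2.1 = p.2.2 ∧ EV (ds p.1 p.2.1)) ∨
    (p.1 = p.2.2 ∧ EV (ds p.1 p.2.1))

theorem ds_comm (x y : ℕ) : ds x y = ds y x := by unfold ds; omega

theorem Pos_swap12 (x y z : ℕ) : Pos (x, y, z) → Pos (y, x, z) := by
  unfold Pos
  have := ds_comm x y
  have := ds_comm x z
  have := ds_comm y z
  grind

theorem Pos_swap23 (x y z : ℕ) : Pos (x, y, z) → Pos (x, z, y) := by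
  unfold Pos
  have := ds_comm x y
  have := ds_comm x z
  have := ds_comm y z
  grind

/-- A move between two piles. -/
def Step (x y u v : ℕ) : Prop :=
  ∃ k, 1 ≤ k ∧ ((x + 2 * k ≤ y ∧ u = x + k ∧ v + k = y) ∨
    (y + 2 * k ≤ x ∧ v = y + k ∧ u + k = x))

theorem Step.symm {x y u v : ℕ} (h : Step x y u v) : Step y x v u := by
  obtain ⟨k, hk, h⟩ := h
  exact ⟨k, hk, by omega⟩

theorem mem_moves (a b c u v w : ℕ) : (u, v, w) ∈ moves (a, b, c) ↔
    (Step a b u v ∧ w = c) ∨ (Step a c u w ∧ v = b) ∨ (Step b c v w ∧ u = a) := by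
  simp only [moves, Finset.mem_union, Finset.mem_image, Finset.mem_Icc, Prod.mk.injEq, Step]
  constructor
  · rintro (((((⟨k, hk⟩ | ⟨k, hk⟩) | ⟨k, hk⟩) | ⟨k, hk⟩) | ⟨k, hk⟩) | ⟨k, hk⟩)
    · exact Or.inl ⟨⟨k, by omega, by omega⟩, by omega⟩
    · exact Or.inl ⟨⟨k, by omega, by omega⟩, by omega⟩
    · exact Or.inr (Or.inl ⟨⟨k, by omega, by omega⟩, by omega⟩)
    · exact Or.inr (Or.inl ⟨⟨k, by omega, by omega⟩, by omega⟩)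
    · exact Or.inr (Or.inr ⟨⟨k, by omega, by omega⟩, by omega⟩)
    · exact Or.inr (Or.inr ⟨⟨k, by omega, by omega⟩, by omega⟩)
  · rintro (⟨⟨k, hk, h | h⟩, e⟩ | ⟨⟨k, hk, h | h⟩, e⟩ | ⟨⟨k, hk, h | h⟩, e⟩)
    · exact Or.inl (Or.inl (Or.inl (Or.inl (Or.inl ⟨k, by omega, by omega⟩))))
    · exact Or.inl (Or.inl (Or.inl (Or.inl (Or.inr ⟨k, by omega, by omega⟩))))
    · exact Or.inl (Or.inl (Or.inl (Or.inr ⟨k, by omega, by omega⟩)))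
    · exact Or.inl (Or.inl (Or.inr ⟨k, by omega, by omega⟩))
    · exact Or.inl (Or.inr ⟨k, by omega, by omega⟩)
    · exact Or.inr ⟨k, by omega, by omega⟩

/-- Some move leads to a position in `Pos`. -/
def Win (x y z : ℕ) : Prop := ∃ u v w, (u, v, w) ∈ moves (x, y, z) ∧ Pos (u, v, w)

theorem Win_swap12 {x y z : ℕ} : Win x y z → Win y x z := by
  rintro ⟨u, v, w, h, hp⟩
  refine ⟨v, u, w, ?_, Pos_swap12 _ _ _ hp⟩
  rw [mem_moves] at h ⊢
  rcases h with ⟨h, e⟩ | ⟨h, e⟩ | ⟨h, e⟩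
  · exact Or.inl ⟨h.symm, e⟩
  · exact Or.inr (Or.inr ⟨h, e⟩)
  · exact Or.inr (Or.inl ⟨h, e⟩)

theorem Win_swap23 {x y z : ℕ} : Win x y z → Win x z y := by
  rintro ⟨u, v, w, h, hp⟩
  refine ⟨u, w, v, ?_, Pos_swap23 _ _ _ hp⟩
  rw [mem_moves] at h ⊢
  rcases h with ⟨h, e⟩ | ⟨h, e⟩ | ⟨h, e⟩
  · exact Or.inr (Or.inl ⟨h, e⟩)
  · exact Or.inl ⟨h, e⟩
  · exact Or.inr (Or.inr ⟨h.symm, e⟩)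

theorem half_of_not_EV {n : ℕ} (h : ¬ EV n) : ∃ m, 0 < m ∧ n = 2 * m ∧ EV m := by
  have h0 : n ≠ 0 := fun e => h (Or.inl e)
  have h1 : n % 2 ≠ 1 := fun e => h (EV_odd e)
  refine ⟨n / 2, by omega, by omega, ?_⟩
  by_contra hc
  apply h
  have := (EV_double (n := n / 2) (by omega)).2 hc
  rwa [show 2 * (n / 2) = n by omega] at this

theorem Win_lt {x y z : ℕ} (hxy : x < y) (hyz : y < z) : Win x y z := by
  by_cases hE : EV (ds (x + z) (2 * y))
  · by_cases hle : 2 * y ≤ x + z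
    · refine ⟨y, y, x + z - y, (mem_moves _ _ _ _ _ _).2 (Or.inr (Or.inl
        ⟨⟨y - x, by omega, by omega⟩, rfl⟩)), Or.inl ⟨rfl, ?_⟩⟩
      convert hE using 1
      simp only [ds]; omega
    · refine ⟨x + z - y, y, y, (mem_moves _ _ _ _ _ _).2 (Or.inr (Or.inl
        ⟨⟨z - y, by omega, by omega⟩, rfl⟩)), Or.inr (Or.inl ⟨rfl, ?_⟩)⟩
      convert hE using 1
      simp only [ds]; omega
  · obtain ⟨m, hm, e, hE'⟩ := half_of_not_EV hE
    unfold ds at e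
    refine ⟨(x + z) / 2, y, (x + z) / 2, (mem_moves _ _ _ _ _ _).2 (Or.inr (Or.inl
        ⟨⟨(z - x) / 2, by omega, by omega⟩, rfl⟩)), Or.inr (Or.inr ⟨rfl, ?_⟩)⟩
    convert hE' using 1
    simp only [ds]; omega

theorem Win_eq {x z : ℕ} (h : ¬ EV (ds x z)) : Win x x z := by
  obtain ⟨m, hm, e, hE⟩ := half_of_not_EV h
  unfold ds at e
  refine ⟨(x + z) / 2, x, (x + z) / 2, (mem_moves _ _ _ _ _ _).2 (Or.inr (Or.inl
        ⟨⟨m, by omega, by omega⟩, rfl⟩)), Or.inr (Or.inr ⟨rfl, ?_⟩)⟩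
  convert hE using 1
  simp only [ds]; omega

theorem Win_of_not_Pos {x y z : ℕ} (h : ¬ Pos (x, y, z)) : Win x y z := by
  by_cases h1 : x = y
  · subst h1
    exact Win_eq fun hE => h (Or.inl ⟨rfl, hE⟩)
  by_cases h2 : y = z
  · subst h2
    exact Win_swap12 (Win_swap23 (Win_eq fun hE => h (Or.inr (Or.inl ⟨rfl, ds_comm y x ▸ hE⟩))))
  by_cases h3 : x = z
  · subst h3
    exact Win_swap23 (Win_eq fun hE => h (Or.inr (Or.inr ⟨rfl, hE⟩)))
  rcases Nat.lt_or_gt_of_ne h1 with a | a <;> rcases Nat.lt_or_gt_of_ne h2 with b | b <;>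
    rcases Nat.lt_or_gt_of_ne h3 with c | c <;> try omega
  · exact Win_lt a b
  · exact Win_swap23 (Win_lt c b)
  · exact Win_swap23 (Win_swap12 (Win_lt c a))
  · exact Win_swap12 (Win_lt a c)
  · exact Win_swap12 (Win_swap23 (Win_lt b c))
  · exact Win_swap12 (Win_swap23 (Win_swap12 (Win_lt b a)))

theorem not_Win_eq {x z : ℕ} (h : EV (ds x z)) : ¬ Win x x z := by
  rintro ⟨u, v, w, hm, hp⟩
  have key : ∀ m, 0 < m → ds x z = 2 * m → ¬ EV m := fun m h0 e => by
    rw [e] at h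
    exact (EV_double h0).1 h
  rw [mem_moves] at hm
  unfold Pos at hp
  rcases hm with ⟨⟨k, hk, hs⟩, e⟩ | ⟨⟨k, hk, hs⟩, e⟩ | ⟨⟨k, hk, hs⟩, e⟩
  · omega
  all_goals
    rcases hp with ⟨e', hE⟩ | ⟨e', hE⟩ | ⟨e', hE⟩ <;> dsimp only at e' hE <;>
      first
      | (exfalso; omega)
      | exact key _ (by unfold ds; omega) (by unfold ds; omega) hE

theorem not_Win_of_Pos {x y z : ℕ} (h : Pos (x, y, z)) : ¬ Win x y z := by
  rcases h with ⟨e, hE⟩ | ⟨e, hE⟩ | ⟨e, hE⟩ <;> dsimp only at e hE <;> subst e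
  · exact not_Win_eq hE
  · exact fun hw => not_Win_eq (ds_comm x y ▸ hE) (Win_swap23 (Win_swap12 hw))
  · exact fun hw => not_Win_eq hE (Win_swap23 hw)

theorem G_eq_zero (p : ℕ × ℕ × ℕ) : G p = 0 ↔ ∀ q ∈ moves p, G q ≠ 0 := by
  rw [G, mex, Nat.sInf_eq_zero]
  have hne : {n : ℕ | n ∉ (moves p).attach.image fun q => G q.1} ≠ ∅ := by
    obtain ⟨n, hn⟩ := Infinite.exists_notMem_finset ((moves p).attach.image fun q => G q.1)
    exact Set.nonempty_iff_ne_empty.1 ⟨n, hn⟩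
  rw [or_iff_left hne]
  simp only [Set.mem_ofPred_eq, Finset.mem_image, Finset.mem_attach, true_and,
    Subtype.exists, not_exists]

theorem G_zero_iff_Pos (n : ℕ) : ∀ p, measure3 p = n → (G p = 0 ↔ Pos p) := by
  induction n using Nat.strong_induction_on with
  | _ n ih =>
    rintro ⟨x, y, z⟩ rfl
    rw [G_eq_zero]
    constructor
    · intro h
      by_contra hc
      obtain ⟨u, v, w, hm, hp⟩ := Win_of_not_Pos hc
      exact h _ hm ((ih _ (measure3_lt_of_mem_moves hm) _ rfl).2 hp)
    · rintro h ⟨u, v, w⟩ hm h0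
      exact not_Win_of_Pos h ⟨u, v, w, hm, (ih _ (measure3_lt_of_mem_moves hm) _ rfl).1 h0⟩

/-- For `0 < a < b`, the position `(0,a,b)` is not a P-position. -/
theorem grundy_ne_zero_of_strict (a b : ℕ) (ha : 0 < a) (hab : a < b) :
    G (0, a, b) ≠ 0 := by
  intro h
  have hp := (G_zero_iff_Pos _ _ rfl).1 h
  unfold Pos at hp
  rcases hp with ⟨e, -⟩ | ⟨e, -⟩ | ⟨e, -⟩ <;> dsimp only at e <;> omega

end SharingNim
end
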